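/- Let n ≥ 1 and let B be a signed chord diagram on n chords whose intersection graph is isomorphic to the path graph on n vertices. Then ∂ε^×_B(z) = ((2^n − 1)/3) z^{n−1} + ((2^{n+1} + 1)/3) z^n if n is even, and ∂ε^×_B(z) = ((2^n + 1)/3) z^{n−1} + ((2^{n+1} − 1)/3) z^n if n is odd. -/

import Mathlib

open Finset Polynomial

/-- A signed chord diagram (bouquet) on a finite chord set `E` with `n` chords:
the `2*n` cyclic positions are labeled by chords via `chord`, each chord occupying
exactly two positions, and each chord carries a sign (`true` = `+1` = untwisted,
`false` = `-1` = twisted). -/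
structure Bouquet (n : ℕ) (E : Type) [Fintype E] [DecidableEq E] where
  chord : Fin (2 * n) → E
  sign : E → Bool
  fiber_two : ∀ e : E, (Finset.univ.filter fun i => chord i = e).card = 2

namespace Bouquet

variable {n : ℕ} {E : Type} [Fintype E] [DecidableEq E]

/-- The partial Petrial `B^{×|A}`: same chord diagram, signs flipped exactly on `A`. -/
def petrial (B : Bouquet n E) (A : Finset E) : Bouquet n E where
  chord := B.chord
  sign := fun e => if e ∈ A then !B.sign e else B.sign e
  fiber_two := B.fiber_two

/-- The boundary graph on the `4*n` points `(i, b)` (with `b = true` meaning `i⁺` and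
`b = false` meaning `i⁻`): the matching `σ` joins `i⁺` to `(i+1)⁻`, and the matching `τ`
joins, for each chord with endpoints `{i, j}`, the points `i⁺,j⁻` and `i⁻,j⁺` when the
sign is `+1`, and the points `i⁺,j⁺` and `i⁻,j⁻` when the sign is `-1`. -/
def boundaryGraph (B : Bouquet n E) : SimpleGraph (Fin (2 * n) × Bool) :=
  SimpleGraph.fromRel fun x y =>
    (x.2 = true ∧ y.2 = false ∧ y.1.val = (x.1.val + 1) % (2 * n)) ∨
    (B.chord x.1 = B.chord y.1 ∧ x.1 ≠ y.1 ∧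
      (if B.sign (B.chord x.1) then x.2 ≠ y.2 else x.2 = y.2))

/-- `f(B)`: the number of boundary components of `B`, i.e. the number of connected
components of the boundary graph. -/
noncomputable def numBoundary (B : Bouquet n E) : ℕ :=
  Nat.card B.boundaryGraph.ConnectedComponent

/-- The Euler genus `ε(B) = n + 1 - f(B)`. -/
noncomputable def eulerGenus (B : Bouquet n E) : ℕ :=
  n + 1 - B.numBoundary

/-- The partial Petrial polynomial `∂ε^×_B(z) = Σ_{A ⊆ E} z^{ε(B^{×|A})}`. -/
noncomputable def petrialPoly (B : Bouquet n E) : Polynomial ℤ :=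
  ∑ A : Finset E, Polynomial.X ^ (B.petrial A).eulerGenus

/-- Two distinct chords are interlaced if exactly one endpoint of the second lies in
one of the two open arcs determined by the endpoints of the first (expressed here by
cutting the circle between positions `2*n - 1` and `0`). -/
def Interlaced (B : Bouquet n E) (e e' : E) : Prop :=
  e ≠ e' ∧ ∃ i j : Fin (2 * n), B.chord i = e ∧ B.chord j = e ∧ i < j ∧
    (Finset.univ.filter fun k => B.chord k = e' ∧ i < k ∧ k < j).card = 1

/-- The intersection graph `I(B)`: vertices are the chords, two chords adjacent iff
interlaced. -/
def intersectionGraph (B : Bouquet n E) : SimpleGraph E :=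
  SimpleGraph.fromRel B.Interlaced

end Bouquet
namespace Bouquet

variable {n : ℕ} {E : Type} [Fintype E] [DecidableEq E]

lemma exists_endpoints (B : Bouquet n E) (e : E) :
    ∃ i j, i < j ∧ ∀ k, B.chord k = e ↔ k = i ∨ k = j := by
  obtain ⟨i, j, hij, h⟩ := Finset.card_eq_two.1 (B.fiber_two e)
  have h' : ∀ k, B.chord k = e ↔ k = i ∨ k = j := fun k => by
    simpa using congrArg (k ∈ ·) h
  rcases lt_or_gt_of_ne hij with hlt | hlt
  · exact ⟨i, j, hlt, h'⟩
  · exact ⟨j, i, hlt, fun k => (h' k).trans or_comm⟩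

lemma card_between (B : Bouquet n E) {e : E} {p q : Fin (2 * n)} (hpq : p < q)
    (h : ∀ k, B.chord k = e ↔ k = p ∨ k = q) (i j : Fin (2 * n)) :
    (univ.filter fun k => B.chord k = e ∧ i < k ∧ k < j).card =
      (if i < p ∧ p < j then 1 else 0) + (if i < q ∧ q < j then 1 else 0) := by
  have hset : (univ.filter fun k => B.chord k = e ∧ i < k ∧ k < j) =
      ({p, q} : Finset _).filter fun k => i < k ∧ k < j := by
    ext k
    simp [h]
  rw [hset, Finset.card_filter, Finset.sum_pair hpq.ne]

lemma interlaced_iff (B : Bouquet n E) {e e' : E} {i j p q : Fin (2 * n)} (hij : i < j)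
    (he : ∀ k, B.chord k = e ↔ k = i ∨ k = j) (hpq : p < q)
    (he' : ∀ k, B.chord k = e' ↔ k = p ∨ k = q) :
    B.Interlaced e e' ↔ e ≠ e' ∧
      (if i < p ∧ p < j then 1 else 0) + (if i < q ∧ q < j then 1 else 0) = 1 := by
  refine and_congr_right fun _ => ⟨?_, fun h => ?_⟩
  · rintro ⟨a, b, ha, hb, hab, h⟩
    rw [he] at ha hb
    obtain ⟨rfl, rfl⟩ : a = i ∧ b = j := by
      rcases ha with rfl | rfl <;> rcases hb with rfl | rfl <;> omega
    rwa [B.card_between hpq he'] at h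
  · exact ⟨i, j, (he i).2 (.inl rfl), (he j).2 (.inr rfl), hij, by rwa [B.card_between hpq he']⟩

lemma Interlaced.symm {B : Bouquet n E} {e e' : E} (h : B.Interlaced e e') :
    B.Interlaced e' e := by
  obtain ⟨i, j, hij, he⟩ := B.exists_endpoints e
  obtain ⟨p, q, hpq, he'⟩ := B.exists_endpoints e'
  rw [B.interlaced_iff hij he hpq he'] at h
  rw [B.interlaced_iff hpq he' hij he]
  obtain ⟨hne, h⟩ := h
  have disj : ∀ k, ¬ ((k = i ∨ k = j) ∧ (k = p ∨ k = q)) := fun k hk =>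
    hne (((he k).2 hk.1).symm.trans ((he' k).2 hk.2))
  have h1 : i ≠ p := fun hh => disj i ⟨.inl rfl, .inl hh⟩
  have h2 : i ≠ q := fun hh => disj i ⟨.inl rfl, .inr hh⟩
  have h3 : j ≠ p := fun hh => disj j ⟨.inr rfl, .inl hh⟩
  have h4 : j ≠ q := fun hh => disj j ⟨.inr rfl, .inr hh⟩
  refine ⟨hne.symm, ?_⟩
  split_ifs at h ⊢ <;> omega

lemma intersectionGraph_adj (B : Bouquet n E) {e e' : E} :
    B.intersectionGraph.Adj e e' ↔ B.Interlaced e e' := by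
  rw [intersectionGraph, SimpleGraph.fromRel_adj]
  exact ⟨fun h => h.2.elim id Interlaced.symm, fun h => ⟨h.1, .inl h⟩⟩

open scoped Classical in
/-- The chords met an odd number of times between the endpoints of `e` are its neighbours in the
intersection graph. -/
lemma sum_between (B : Bouquet n E) {e : E} {i j : Fin (2 * n)} (hij : i < j)
    (he : ∀ k, B.chord k = e ↔ k = i ∨ k = j) (x : E → ZMod 2) :
    ∑ k with i < k ∧ k < j, x (B.chord k) = ∑ e' with B.intersectionGraph.Adj e e', x e' := by
  rw [← Finset.sum_fiberwise (univ.filter fun k => i < k ∧ k < j) B.chord, Finset.sum_filter]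
  refine Finset.sum_congr rfl fun e' _ => ?_
  rw [Finset.sum_congr rfl (g := fun _ => x e') (by simp +contextual), Finset.sum_const,
    Finset.filter_filter]
  have hcomm : (univ.filter fun k => (i < k ∧ k < j) ∧ B.chord k = e') =
      univ.filter fun k => B.chord k = e' ∧ i < k ∧ k < j := by
    ext k; simp [and_comm]
  obtain ⟨p, q, hpq, he'⟩ := B.exists_endpoints e'
  rw [hcomm, B.card_between hpq he', intersectionGraph_adj, B.interlaced_iff hij he hpq he']
  by_cases hee : e = e'
  · subst hee
    have hp := (he p).1 ((he' p).2 (.inl rfl))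
    have hq := (he q).1 ((he' q).2 (.inr rfl))
    have h1 : ¬ (i < p ∧ p < j) := by omega
    have h2 : ¬ (i < q ∧ q < j) := by omega
    simp [h1, h2]
  · have h2 : (2 : ZMod 2) = 0 := by decide
    split_ifs <;> simp_all

/-- The vectors annihilated by the adjacency matrix of `G` over the field with two elements, with
diagonal entries `1` at the twisted vertices. -/
def twistedKernel (G : SimpleGraph E) (s : E → Bool) : Set (E → ZMod 2) :=
  open scoped Classical in
  {x | ∀ e, (if s e then 0 else x e) + ∑ e' with G.Adj e e', x e' = 0}

/-- Sum of `x` over the first `m` positions. -/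
def prefixSum (B : Bouquet n E) (x : E → ZMod 2) (m : ℕ) : ZMod 2 :=
  ∑ k : Fin (2 * n) with k.val < m, x (B.chord k)

lemma prefixSum_zero (B : Bouquet n E) (x : E → ZMod 2) : B.prefixSum x 0 = 0 := by
  simp [prefixSum]

lemma prefixSum_succ (B : Bouquet n E) (x : E → ZMod 2) (i : Fin (2 * n)) :
    B.prefixSum x (i + 1) = B.prefixSum x i + x (B.chord i) := by
  have : (univ.filter fun k : Fin (2 * n) => k.val < i + 1) =
      insert i (univ.filter fun k : Fin (2 * n) => k.val < i) := by
    ext k; simp [Fin.ext_iff]; omega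
  rw [prefixSum, this, Finset.sum_insert (by simp), add_comm, prefixSum]

lemma prefixSum_two_mul (B : Bouquet n E) (x : E → ZMod 2) : B.prefixSum x (2 * n) = 0 := by
  rw [prefixSum, Finset.filter_true_of_mem (fun k _ => k.isLt), ← Finset.sum_fiberwise univ B.chord]
  refine Finset.sum_eq_zero fun e _ => ?_
  rw [Finset.sum_congr rfl (g := fun _ => x e) (by simp +contextual), Finset.sum_const,
    B.fiber_two e, two_nsmul, CharTwo.add_self_eq_zero]

open scoped Classical in
lemma prefixSum_endpoint (B : Bouquet n E) {e : E} {i j : Fin (2 * n)} (hij : i < j)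
    (he : ∀ k, B.chord k = e ↔ k = i ∨ k = j) (x : E → ZMod 2) :
    B.prefixSum x j =
      B.prefixSum x i + x e + ∑ e' with B.intersectionGraph.Adj e e', x e' := by
  rw [← (he i).2 (.inl rfl), ← prefixSum_succ, (he i).2 (.inl rfl), ← B.sum_between hij he,
    prefixSum, prefixSum, ← Finset.sum_union]
  · congr 1
    ext k; simp; omega
  · rw [Finset.disjoint_filter]; intro k _; omega

/-- The potential on the boundary points whose jumps at the positions are given by `x`. -/
def potential (B : Bouquet n E) (c : ZMod 2) (x : E → ZMod 2) (p : Fin (2 * n) × Bool) : ZMod 2 :=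
  c + B.prefixSum x (if p.2 then p.1 + 1 else p.1)

/-- Functions constant along the edges of the boundary graph. -/
def locallyConstant (B : Bouquet n E) : Set (Fin (2 * n) × Bool → ZMod 2) :=
  {g | ∀ p q, B.boundaryGraph.Adj p q → g p = g q}

lemma mem_locallyConstant (B : Bouquet n E) (g : Fin (2 * n) × Bool → ZMod 2) :
    g ∈ B.locallyConstant ↔
      (∀ i j : Fin (2 * n), j.val = (i.val + 1) % (2 * n) → g (i, true) = g (j, false)) ∧
      ∀ i j, i < j → B.chord i = B.chord j → ∀ b,
        g (i, b) = g (j, if B.sign (B.chord i) then !b else b) := by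
  constructor
  · intro h
    refine ⟨fun i j hij => h _ _ ?_, fun i j hij hc b => h _ _ ?_⟩
    · rw [boundaryGraph, SimpleGraph.fromRel_adj]
      exact ⟨by simp, .inl (.inl ⟨rfl, rfl, hij⟩)⟩
    · rw [boundaryGraph, SimpleGraph.fromRel_adj]
      refine ⟨fun hh => hij.ne (congrArg Prod.fst hh), .inl (.inr ⟨hc, hij.ne, ?_⟩)⟩
      cases B.sign (B.chord i) <;> simp
  · rintro ⟨h1, h2⟩
    have key : ∀ p q : Fin (2 * n) × Bool,
        ((p.2 = true ∧ q.2 = false ∧ q.1.val = (p.1.val + 1) % (2 * n)) ∨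
          (B.chord p.1 = B.chord q.1 ∧ p.1 ≠ q.1 ∧
            (if B.sign (B.chord p.1) then p.2 ≠ q.2 else p.2 = q.2))) → g p = g q := by
      rintro ⟨i, b⟩ ⟨j, b'⟩ (⟨hb, hb', h⟩ | ⟨hc, hne, h⟩)
      · simp only at hb hb' h
        subst hb hb'
        exact h1 i j h
      · simp only at hc hne h
        rcases lt_or_gt_of_ne hne with hlt | hlt
        · rw [h2 i j hlt hc b]
          cases hs : B.sign (B.chord i) <;> cases b <;> cases b' <;> simp_all
        · rw [h2 j i hlt hc.symm b']
          cases hs : B.sign (B.chord i) <;> cases b <;> cases b' <;> simp_all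
    intro p q hpq
    rw [boundaryGraph, SimpleGraph.fromRel_adj] at hpq
    exact hpq.2.elim (key p q) fun h => (key q p h).symm

lemma potential_mem (B : Bouquet n E) (c : ZMod 2) (x : E → ZMod 2) :
    B.potential c x ∈ B.locallyConstant ↔ x ∈ twistedKernel B.intersectionGraph B.sign := by
  classical
  have hchord : ∀ {e : E} {i j : Fin (2 * n)}, i < j → (∀ k, B.chord k = e ↔ k = i ∨ k = j) →
      ((∀ b, B.potential c x (i, b) = B.potential c x (j, if B.sign e then !b else b)) ↔
        (if B.sign e then 0 else x e) + ∑ e' with B.intersectionGraph.Adj e e', x e' = 0) := by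
    intro e i j hij he
    have hj := B.prefixSum_endpoint hij he x
    have hi1 := B.prefixSum_succ x i
    have hj1 := B.prefixSum_succ x j
    rw [(he i).2 (.inl rfl)] at hi1
    rw [(he j).2 (.inr rfl)] at hj1
    simp only [potential, Bool.forall_bool, if_true, Bool.false_eq_true, if_false]
    generalize B.prefixSum x i = a at *
    generalize (∑ e' with B.intersectionGraph.Adj e e', x e') = t at *
    generalize x e = u at *
    cases B.sign e <;> simp only [Bool.not_true, Bool.not_false, if_true, if_false,
      Bool.false_eq_true, hi1, hj1, hj] <;> clear hi1 hj1 hj <;> revert c a t u <;> decide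
  rw [mem_locallyConstant]
  constructor
  · rintro ⟨-, h⟩ e
    obtain ⟨i, j, hij, he⟩ := B.exists_endpoints e
    have hi := (he i).2 (.inl rfl)
    have hj := (he j).2 (.inr rfl)
    convert (hchord hij he).1 (by simpa [hi] using h i j hij (hi.trans hj.symm))
  · intro h
    refine ⟨fun i j hij => ?_, fun i j hij hc => ?_⟩
    · simp only [potential, if_true, Bool.false_eq_true, if_false, hij]
      rcases Nat.lt_or_ge (i.val + 1) (2 * n) with hlt | hge
      · rw [Nat.mod_eq_of_lt hlt]
      · have : i.val + 1 = 2 * n := by omega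
        rw [this, Nat.mod_self, prefixSum_zero, prefixSum_two_mul]
    · obtain ⟨p, q, hpq, he⟩ := B.exists_endpoints (B.chord i)
      have hi := (he i).1 rfl
      have hj := (he j).1 hc.symm
      obtain ⟨rfl, rfl⟩ : p = i ∧ q = j := by omega
      exact (hchord hij he).2 (by convert h (B.chord p))

lemma potential_injective (B : Bouquet n E) (hn : 1 ≤ n) {c c' : ZMod 2} {x x' : E → ZMod 2}
    (h : B.potential c x = B.potential c' x') : c = c' ∧ x = x' := by
  have hc : c = c' := by
    simpa [potential, prefixSum_zero] using congrFun h (⟨0, by omega⟩, false)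
  refine ⟨hc, funext fun e => ?_⟩
  obtain ⟨i, j, -, he⟩ := B.exists_endpoints e
  have h1 := congrFun h (i, true)
  have h2 := congrFun h (i, false)
  simp only [potential, if_true, Bool.false_eq_true, if_false, prefixSum_succ,
    (he i).2 (.inl rfl), hc, add_right_inj] at h1 h2
  simpa [h2] using h1

lemma exists_potential (B : Bouquet n E) (hn : 1 ≤ n) {g : Fin (2 * n) × Bool → ZMod 2}
    (hg : g ∈ B.locallyConstant) : ∃ c x, B.potential c x = g := by
  rw [mem_locallyConstant] at hg
  obtain ⟨h1, h2⟩ := hg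
  choose p q hpq he using B.exists_endpoints
  let x : E → ZMod 2 := fun e => g (p e, true) - g (p e, false)
  have hx : ∀ k, g (k, true) = g (k, false) + x (B.chord k) := by
    intro k
    rcases (he (B.chord k) k).1 rfl with hk | hk
    · simp only [x]; rw [← hk]; ring
    · have hp : B.chord (p (B.chord k)) = B.chord k := (he _ _).2 (.inl rfl)
      have := h2 (p (B.chord k)) k (by have := hpq (B.chord k); omega) hp
      have ht := this true
      have hf := this false
      simp only [x]
      rw [ht, hf]
      have hadd : ∀ a b : ZMod 2, a = b + (b - a) := by decide
      cases B.sign (B.chord (p (B.chord k)))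
      · simp
      · simpa using hadd _ _
  refine ⟨g (⟨0, by omega⟩, false), x, ?_⟩
  have hfalse : ∀ m (hm : m < 2 * n),
      g (⟨m, hm⟩, false) = g (⟨0, by omega⟩, false) + B.prefixSum x m := by
    intro m
    induction m with
    | zero => intro _; simp [prefixSum_zero]
    | succ m ih =>
      intro hm
      rw [← h1 ⟨m, by omega⟩ ⟨m + 1, hm⟩ (Nat.mod_eq_of_lt hm).symm, hx, ih (by omega), add_assoc,
        ← prefixSum_succ B x ⟨m, by omega⟩]
  ext ⟨k, b⟩
  cases b
  · simp [potential, hfalse k k.isLt]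
  · simp [potential, hx, hfalse k k.isLt, prefixSum_succ, add_assoc]

/-- Functions constant on the boundary components are functions on the set of components. -/
def locallyConstantEquiv (B : Bouquet n E) :
    (B.boundaryGraph.ConnectedComponent → ZMod 2) ≃ B.locallyConstant where
  toFun f := ⟨fun p => f (B.boundaryGraph.connectedComponentMk p), fun _ _ h =>
    congrArg f (SimpleGraph.ConnectedComponent.sound h.reachable)⟩
  invFun g := fun c => c.lift g.1 fun _ _ w hw => by
    clear hw
    induction w with
    | nil => rfl
    | cons h w ih => exact (g.2 _ _ h).trans ih
  left_inv f := by
    ext c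
    induction c using SimpleGraph.ConnectedComponent.ind
    rfl
  right_inv g := rfl

/-- The number of boundary components is one more than the corank of the twisted adjacency matrix
of the intersection graph. -/
theorem two_pow_numBoundary (B : Bouquet n E) (hn : 1 ≤ n) :
    2 ^ B.numBoundary = 2 * Nat.card (twistedKernel B.intersectionGraph B.sign) := by
  have e1 := Nat.card_congr B.locallyConstantEquiv
  rw [Nat.card_fun, Nat.card_zmod] at e1
  rw [numBoundary, e1]
  have e2 : Function.Bijective
      (fun y : ZMod 2 × twistedKernel B.intersectionGraph B.sign =>
        (⟨B.potential y.1 y.2, (B.potential_mem _ _).2 y.2.2⟩ : B.locallyConstant)) := by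
    constructor
    · rintro ⟨c, x, hx⟩ ⟨c', x', hx'⟩ h
      obtain ⟨rfl, rfl⟩ := B.potential_injective hn (congrArg Subtype.val h)
      rfl
    · rintro ⟨g, hg⟩
      obtain ⟨c, x, rfl⟩ := B.exists_potential hn hg
      exact ⟨(c, ⟨x, (B.potential_mem _ _).1 hg⟩), rfl⟩
  rw [← Nat.card_eq_of_bijective _ e2, Nat.card_prod, Nat.card_zmod]

end Bouquet

/-- The continuant over the field with two elements with coefficient `1` at the indices in `A`. -/
def continuant (A : Finset ℕ) : ℕ → ZMod 2
  | 0 => 0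
  | 1 => 1
  | k + 2 => (if k ∈ A then 1 else 0) * continuant A (k + 1) + continuant A k

lemma continuant_congr {A A' : Finset ℕ} {m : ℕ} (h : ∀ k < m, k ∈ A ↔ k ∈ A') :
    ∀ k ≤ m + 1, continuant A k = continuant A' k
  | 0, _ => rfl
  | 1, _ => rfl
  | k + 2, hk => by
    rw [continuant, continuant, continuant_congr h (k + 1) (by omega),
      continuant_congr h k (by omega)]
    simp only [h k (by omega)]

lemma continuant_succ_ne_zero (A : Finset ℕ) (k : ℕ) (h : continuant A k = 0) :
    continuant A (k + 1) = 1 := by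
  have hcase : ∀ a : ZMod 2, a = 0 ∨ a = 1 := by decide
  induction k with
  | zero => rfl
  | succ k ih =>
    have h1 : continuant A k = 1 := (hcase _).resolve_left fun h0 => by simp [ih h0] at h
    rw [continuant, h, h1]
    simp

/-- The number of subsets of `range n` whose continuant vanishes. -/
def singularCount (n : ℕ) : ℕ := #{A ∈ (range n).powerset | continuant A (n + 1) = 0}

lemma singularCount_succ (n : ℕ) : singularCount (n + 1) + singularCount n = 2 ^ n := by
  have hcase : ∀ a : ZMod 2, a = 0 ∨ a = 1 := by decide
  rw [singularCount, singularCount, Finset.card_filter, Finset.card_filter, Finset.range_add_one,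
    Finset.sum_powerset_insert (by simp), ← Finset.sum_add_distrib, ← Finset.sum_add_distrib]
  rw [Finset.sum_congr rfl (g := fun _ => 1), Finset.sum_const, Finset.card_powerset,
    Finset.card_range, smul_eq_mul, mul_one]
  intro A hA
  have hnA : n ∉ A := fun h => by simpa using Finset.mem_powerset.1 hA h
  have hins : ∀ k ≤ n + 1, continuant (insert n A) k = continuant A k :=
    continuant_congr fun k hk => by simp [hk.ne]
  rw [continuant, continuant, hins (n + 1) le_rfl, hins n (by omega)]
  have hne := continuant_succ_ne_zero A n
  rcases hcase (continuant A n) with h0 | h0 <;>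
    rcases hcase (continuant A (n + 1)) with h1 | h1 <;>
    simp_all [CharTwo.add_self_eq_zero (1 : ZMod 2)]

lemma three_mul_singularCount (n : ℕ) :
    3 * (singularCount n : ℤ) = 2 ^ n - (-1) ^ n := by
  induction n with
  | zero => simp [singularCount, continuant]
  | succ n ih =>
    have := singularCount_succ n
    zify at this
    rw [pow_succ, pow_succ]
    linarith

/-- The path index set of the twisted vertices. -/
def twistedIndices {n : ℕ} {E : Type} [Fintype E] (φ : E ≃ Fin n) (s : E → Bool) : Finset ℕ :=
  (univ.filter fun e => s e = false).image fun e => (φ e).val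

lemma mem_twistedIndices {n : ℕ} {E : Type} [Fintype E] (φ : E ≃ Fin n) (s : E → Bool) (e : E) :
    (φ e).val ∈ twistedIndices φ s ↔ s e = false := by
  simp only [twistedIndices, Finset.mem_image, Finset.mem_filter, Finset.mem_univ, true_and]
  refine ⟨?_, fun h => ⟨e, h, rfl⟩⟩
  rintro ⟨e', he', h⟩
  rwa [← φ.injective (Fin.ext h)]

/-- The entries of `x` along a path, shifted by one and padded by zeros. -/
def pathExtend {n : ℕ} {E : Type} (φ : E ≃ Fin n) (x : E → ZMod 2) (k : ℕ) : ZMod 2 :=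
  if h : 1 ≤ k ∧ k ≤ n then x (φ.symm ⟨k - 1, by omega⟩) else 0

lemma pathExtend_apply {n : ℕ} {E : Type} (φ : E ≃ Fin n) (x : E → ZMod 2) (e : E) :
    pathExtend φ x (φ e + 1) = x e := by
  have := (φ e).isLt
  rw [pathExtend, dif_pos (by omega)]
  simp

lemma pathExtend_eq_mul_continuant {n : ℕ} {E : Type} (φ : E ≃ Fin n) (A : Finset ℕ) (x : E → ZMod 2)
    (h : ∀ k < n, pathExtend φ x (k + 2) =
      (if k ∈ A then 1 else 0) * pathExtend φ x (k + 1) + pathExtend φ x k) :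
    ∀ k ≤ n + 1, pathExtend φ x k = pathExtend φ x 1 * continuant A k
  | 0, _ => by simp [pathExtend, continuant]
  | 1, _ => by simp [continuant]
  | k + 2, hk => by
    rw [h k (by omega), pathExtend_eq_mul_continuant φ A x h (k + 1) (by omega),
      pathExtend_eq_mul_continuant φ A x h k (by omega), continuant]
    ring

namespace Bouquet

variable {n : ℕ} {E : Type} [Fintype E] [DecidableEq E]

open scoped Classical in
lemma sum_adj_path {G : SimpleGraph E} (φ : G ≃g SimpleGraph.pathGraph n) (x : E → ZMod 2)
    (e : E) : ∑ e' with G.Adj e e', x e' =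
      pathExtend φ.toEquiv x (φ e) + pathExtend φ.toEquiv x (φ e + 2) := by
  have key : ∀ k : ℕ, ∑ e' with (φ e').val + 1 = k, x e' = pathExtend φ.toEquiv x k := by
    intro k
    by_cases hk : 1 ≤ k ∧ k ≤ n
    · rw [pathExtend, dif_pos hk, Finset.sum_eq_single_of_mem (φ.toEquiv.symm ⟨k - 1, by omega⟩)]
      · have : φ (φ.toEquiv.symm ⟨k - 1, by omega⟩) = ⟨k - 1, by omega⟩ :=
          φ.toEquiv.apply_symm_apply _
        simp only [Finset.mem_filter, Finset.mem_univ, true_and, this]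
        omega
      · intro b hb hne
        refine absurd ?_ hne
        rw [Equiv.eq_symm_apply, Fin.ext_iff]
        have := (Finset.mem_filter.1 hb).2
        change (φ b).val = k - 1
        omega
    · rw [pathExtend, dif_neg hk, Finset.filter_false_of_mem, Finset.sum_empty]
      intro e' _ h
      have := (φ e').isLt
      omega
  rw [← key, ← key, ← Finset.sum_union]
  · congr 1
    ext e'
    rw [Finset.mem_union, Finset.mem_filter, Finset.mem_filter, Finset.mem_filter,
      ← φ.map_adj_iff, SimpleGraph.pathGraph_adj]
    simp only [Finset.mem_univ, true_and]
    omega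
  · rw [Finset.disjoint_filter]; intro k _; omega

lemma mem_twistedKernel_path {G : SimpleGraph E} (φ : G ≃g SimpleGraph.pathGraph n)
    (s : E → Bool) (x : E → ZMod 2) :
    x ∈ twistedKernel G s ↔ ∀ k < n, pathExtend φ.toEquiv x (k + 2) =
      (if k ∈ twistedIndices φ.toEquiv s then 1 else 0) * pathExtend φ.toEquiv x (k + 1) +
        pathExtend φ.toEquiv x k := by
  have hmem : ∀ e, (φ e).val ∈ twistedIndices φ.toEquiv s ↔ s e = false :=
    mem_twistedIndices φ.toEquiv s
  have hequiv : ∀ e, ((if s e then 0 else x e) + (pathExtend φ.toEquiv x (φ e) +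
      pathExtend φ.toEquiv x (φ e + 2)) = 0 ↔ pathExtend φ.toEquiv x (φ e + 2) =
      (if (φ e).val ∈ twistedIndices φ.toEquiv s then 1 else 0) *
        pathExtend φ.toEquiv x (φ e + 1) + pathExtend φ.toEquiv x (φ e)) := by
    intro e
    have hx : pathExtend φ.toEquiv x (φ e + 1) = x e := pathExtend_apply φ.toEquiv x e
    rw [hx]
    simp only [hmem]
    generalize pathExtend φ.toEquiv x (φ e) = a
    generalize pathExtend φ.toEquiv x (φ e + 2) = b
    generalize x e = c
    cases s e <;> revert a b c <;> decide
  simp only [twistedKernel, Set.mem_ofPred_eq, sum_adj_path φ, hequiv]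
  constructor
  · intro h k hk
    simpa using h (φ.symm ⟨k, hk⟩)
  · exact fun h e => h _ (φ e).isLt

lemma card_twistedKernel_path {G : SimpleGraph E} (hn : 1 ≤ n)
    (φ : G ≃g SimpleGraph.pathGraph n) (s : E → Bool) :
    Nat.card (twistedKernel G s) =
      if continuant (twistedIndices φ.toEquiv s) (n + 1) = 0 then 2 else 1 := by
  set A := twistedIndices φ.toEquiv s
  have hlast : ∀ x, pathExtend φ.toEquiv x (n + 1) = 0 := fun x => by simp [pathExtend]
  have hbij : Function.Bijective
      (fun x : twistedKernel G s => (⟨pathExtend φ.toEquiv x 1, by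
        rw [← pathExtend_eq_mul_continuant _ A _
          ((mem_twistedKernel_path φ s x).1 x.2) _ le_rfl, hlast]⟩ :
        {c : ZMod 2 // c * continuant A (n + 1) = 0})) := by
    constructor
    · rintro ⟨x, hx⟩ ⟨x', hx'⟩ h
      have h1 : pathExtend φ.toEquiv x 1 = pathExtend φ.toEquiv x' 1 := congrArg Subtype.val h
      refine Subtype.ext (funext fun e => ?_)
      have hle : (φ.toEquiv e).val + 1 ≤ n + 1 := by omega
      change x e = x' e
      rw [← pathExtend_apply φ.toEquiv x e, ← pathExtend_apply φ.toEquiv x' e,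
        pathExtend_eq_mul_continuant _ A _ ((mem_twistedKernel_path φ s x).1 hx) _ hle,
        pathExtend_eq_mul_continuant _ A _ ((mem_twistedKernel_path φ s x').1 hx') _ hle, h1]
    · rintro ⟨c, hc⟩
      let x : E → ZMod 2 := fun e => c * continuant A (φ e + 1)
      have hx : ∀ k ≤ n + 1, pathExtend φ.toEquiv x k = c * continuant A k := by
        intro k hk
        by_cases h : 1 ≤ k ∧ k ≤ n
        · obtain ⟨k, rfl⟩ : ∃ m, k = m + 1 := ⟨k - 1, by omega⟩
          have := pathExtend_apply φ.toEquiv x (φ.toEquiv.symm ⟨k, by omega⟩)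
          rw [Equiv.apply_symm_apply] at this
          rw [this]
          change c * continuant A ((φ.toEquiv (φ.toEquiv.symm ⟨k, by omega⟩)).val + 1) = _
          rw [Equiv.apply_symm_apply]
        · obtain rfl | rfl : k = 0 ∨ k = n + 1 := by omega
          · simp [pathExtend, continuant]
          · rw [hlast, hc]
      refine ⟨⟨x, (mem_twistedKernel_path φ s x).2 fun k hk => ?_⟩, Subtype.ext ?_⟩
      · rw [hx _ (by omega), hx _ (by omega), hx _ (by omega), continuant]
        ring
      · simpa [continuant] using hx 1 (by omega)
  rw [Nat.card_eq_of_bijective _ hbij, Nat.card_eq_fintype_card]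
  generalize continuant A (n + 1) = a
  revert a
  decide

lemma eulerGenus_of_path (B : Bouquet n E) (hn : 1 ≤ n)
    (φ : B.intersectionGraph ≃g SimpleGraph.pathGraph n) :
    B.eulerGenus =
      if continuant (twistedIndices φ.toEquiv B.sign) (n + 1) = 0 then n - 1 else n := by
  have h := B.two_pow_numBoundary hn
  rw [card_twistedKernel_path hn φ] at h
  rw [eulerGenus]
  split_ifs at h ⊢
  · have := Nat.pow_right_injective le_rfl (show 2 ^ B.numBoundary = 2 ^ 2 from h)
    omega
  · have := Nat.pow_right_injective le_rfl (show 2 ^ B.numBoundary = 2 ^ 1 from h)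
    omega

lemma petrialPoly_eq_sum_range (B : Bouquet n E) (hn : 1 ≤ n)
    (φ : B.intersectionGraph ≃g SimpleGraph.pathGraph n) :
    B.petrialPoly = ∑ A ∈ (range n).powerset,
      X ^ (if continuant A (n + 1) = 0 then n - 1 else n) := by
  let t : Finset E → Finset ℕ := fun A => twistedIndices φ.toEquiv (B.petrial A).sign
  have hmem : ∀ (A : Finset E) (e : E), (φ e).val ∈ t A ↔ (B.petrial A).sign e = false :=
    fun A => mem_twistedIndices φ.toEquiv (B.petrial A).sign
  refine Finset.sum_bij (fun A _ => t A) ?_ ?_ ?_ ?_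
  · intro A _
    rw [Finset.mem_powerset]
    intro k hk
    obtain ⟨e, -, rfl⟩ := Finset.mem_image.1 hk
    exact Finset.mem_range.2 (φ e).isLt
  · intro A _ A' _ h
    ext e
    have := (hmem A e).symm.trans ((Finset.ext_iff.1 h _).trans (hmem A' e))
    simp only [petrial] at this
    by_cases h1 : e ∈ A <;> by_cases h2 : e ∈ A' <;> cases hs : B.sign e <;> simp_all
  · intro S hS
    refine ⟨univ.filter fun e => (B.sign e = true ↔ (φ e).val ∈ S), Finset.mem_univ _, ?_⟩
    ext k
    by_cases hk : k < n
    · obtain ⟨e, he⟩ : ∃ e, φ e = ⟨k, hk⟩ := φ.surjective _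
      obtain rfl : (φ e).val = k := by rw [he]
      rw [hmem]
      by_cases h : (φ e).val ∈ S <;> cases hs : B.sign e <;> simp [petrial, h, hs]
    · refine iff_of_false (fun h => ?_) fun h => hk (by simpa using Finset.mem_powerset.1 hS h)
      obtain ⟨e, -, rfl⟩ := Finset.mem_image.1 h
      exact hk (φ e).isLt
  · intro A _
    exact congrArg (X ^ ·) ((B.petrial A).eulerGenus_of_path hn φ)

lemma petrialPoly_of_path (B : Bouquet n E) (hn : 1 ≤ n)
    (φ : B.intersectionGraph ≃g SimpleGraph.pathGraph n) :
    B.petrialPoly = C (singularCount n : ℤ) * X ^ (n - 1) +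
      C (2 ^ n - singularCount n : ℤ) * X ^ n := by
  have hcard := Finset.card_filter_add_card_filter_not (s := (range n).powerset)
    (fun A => continuant A (n + 1) = 0)
  rw [Finset.card_powerset, Finset.card_range] at hcard
  change singularCount n + _ = _ at hcard
  have hcard' : (2 ^ n - singularCount n : ℤ) =
      (#{A ∈ (range n).powerset | ¬ continuant A (n + 1) = 0} : ℤ) := by
    zify at hcard
    linarith
  rw [B.petrialPoly_eq_sum_range hn φ, hcard']
  simp only [apply_ite (fun m => (X : ℤ[X]) ^ m)]
  rw [Finset.sum_ite, Finset.sum_const, Finset.sum_const]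
  simp [singularCount]

end Bouquet

/-- The partial Petrial polynomial of a bouquet on `n ≥ 1` chords whose intersection
graph is (isomorphic to) the path graph on `n` vertices:
`((2^n − 1)/3) z^{n−1} + ((2^{n+1} + 1)/3) z^n` for even `n`, and
`((2^n + 1)/3) z^{n−1} + ((2^{n+1} − 1)/3) z^n` for odd `n`. -/
theorem stmt14 {n : ℕ} (hn : 1 ≤ n) {E : Type} [Fintype E] [DecidableEq E]
    (B : Bouquet n E) (hiso : Nonempty (B.intersectionGraph ≃g SimpleGraph.pathGraph n)) :
    B.petrialPoly =
      if n % 2 = 0 then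
        Polynomial.C (((2 ^ n - 1) / 3 : ℤ)) * Polynomial.X ^ (n - 1) +
          Polynomial.C (((2 ^ (n + 1) + 1) / 3 : ℤ)) * Polynomial.X ^ n
      else
        Polynomial.C (((2 ^ n + 1) / 3 : ℤ)) * Polynomial.X ^ (n - 1) +
          Polynomial.C (((2 ^ (n + 1) - 1) / 3 : ℤ)) * Polynomial.X ^ n := by
  obtain ⟨φ⟩ := hiso
  have h := three_mul_singularCount n
  rw [B.petrialPoly_of_path hn φ, pow_succ]
  split_ifs with hpar
  · rw [(Nat.even_iff.2 hpar).neg_one_pow] at h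
    congr 3 <;> omega
  · rw [(Nat.odd_iff.2 (by omega)).neg_one_pow] at h
    congr 3 <;> omega
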